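/- Let A be an M × r complex matrix and let ι : {1,…,r} → {1,…,M} be an injection such that the square submatrix Â formed by the rows A_{ι(1),:}, …, A_{ι(r),:} is invertible. Set C = A Â^{-1} and let c = max_{i,j} |C_{i,j}| be the maximal absolute value of an entry of C. Then for every injection κ : {1,…,r} → {1,…,M}, the r × r submatrix A_κ formed by the rows A_{κ(1),:}, …, A_{κ(r),:} satisfies |det(A_κ)| ≤ (c √r)^r · |det(Â)|. In particular, if the maximal volume among r × r row submatrices exceeds Γ · |det Â|, then some entry of C satisfies |C_{i,j}| ≥ Γ^{1/r}/√r. -/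

import Mathlib

open Matrix BigOperators

/-- The inequality of arithmetic and geometric means, with natural powers. -/
theorem Finset.prod_le_arith_mean_pow {ι : Type*} [Fintype ι] (z : ι → ℝ) (hz : ∀ i, 0 ≤ z i) :
    ∏ i, z i ≤ ((∑ i, z i) / Fintype.card ι) ^ Fintype.card ι := by
  rcases isEmpty_or_nonempty ι with h | h
  · simp
  have hcard : Fintype.card ι ≠ 0 := Fintype.card_ne_zero
  have hpos : (0 : ℝ) < Fintype.card ι := by exact_mod_cast Nat.pos_of_ne_zero hcard
  have key := Real.geom_mean_le_arith_mean Finset.univ (fun _ ↦ (1 : ℝ)) z (by simp)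
    (by simpa using hpos) (fun i _ ↦ hz i)
  simp only [Real.rpow_one, Finset.sum_const, Finset.card_univ, nsmul_eq_mul, mul_one,
    one_mul] at key
  have hprod : 0 ≤ ∏ i, z i := Finset.prod_nonneg fun i _ ↦ hz i
  calc ∏ i, z i = ((∏ i, z i) ^ (Fintype.card ι : ℝ)⁻¹) ^ Fintype.card ι :=
        (Real.rpow_inv_natCast_pow hprod hcard).symm
    _ ≤ _ := pow_le_pow_left₀ (Real.rpow_nonneg hprod _) key _

open scoped ComplexOrder in
/-- Hadamard's determinant inequality for matrices with entries bounded by `c`. -/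
theorem Matrix.norm_det_le_of_norm_le {n 𝕜 : Type*} [Fintype n] [DecidableEq n] [RCLike 𝕜]
    (B : Matrix n n 𝕜) {c : ℝ} (hB : ∀ i j, ‖B i j‖ ≤ c) :
    ‖B.det‖ ≤ (c * √(Fintype.card n)) ^ Fintype.card n := by
  rcases isEmpty_or_nonempty n with h | ⟨⟨i₀⟩⟩
  · simp
  have hc : 0 ≤ c := (norm_nonneg _).trans (hB i₀ i₀)
  have hpos : (0 : ℝ) < Fintype.card n := by
    exact_mod_cast Fintype.card_pos_iff.mpr ⟨i₀⟩
  have hpsd := posSemidef_conjTranspose_mul_self B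
  have hdet : ∏ i, hpsd.isHermitian.eigenvalues i = ‖B.det‖ ^ 2 := by
    have h := hpsd.isHermitian.det_eq_prod_eigenvalues
    rw [det_mul, det_conjTranspose, RCLike.star_def, RCLike.conj_mul] at h
    exact_mod_cast h.symm
  have htrace : ∑ i, hpsd.isHermitian.eigenvalues i = ∑ i, ∑ j, ‖B j i‖ ^ 2 := by
    have h := hpsd.isHermitian.trace_eq_sum_eigenvalues
    simp only [trace, diag_apply, mul_apply, conjTranspose_apply, RCLike.star_def,
      RCLike.conj_mul] at h
    exact_mod_cast h.symm
  have hsum : ∑ i, ∑ j, ‖B j i‖ ^ 2 ≤ Fintype.card n * (Fintype.card n * c ^ 2) := by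
    calc ∑ i, ∑ j, ‖B j i‖ ^ 2 ≤ ∑ _i : n, ∑ _j : n, c ^ 2 := by
          gcongr with i _ j _
          exact hB j i
      _ = _ := by simp
  refine le_of_sq_le_sq ?_ (by positivity)
  calc ‖B.det‖ ^ 2 ≤ ((∑ i, ∑ j, ‖B j i‖ ^ 2) / Fintype.card n) ^ Fintype.card n := by
        rw [← hdet, ← htrace]
        exact Finset.prod_le_arith_mean_pow _ hpsd.eigenvalues_nonneg
    _ ≤ (Fintype.card n * c ^ 2) ^ Fintype.card n := by
        gcongr
        rwa [div_le_iff₀' hpos]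
    _ = ((c * √(Fintype.card n)) ^ Fintype.card n) ^ 2 := by
        rw [pow_right_comm, mul_pow c, Real.sq_sqrt hpos.le, mul_comm (c ^ 2)]

/-- Let `Â = A.submatrix ι id` be an invertible `r × r` row submatrix of `A`, let
`C = A Â⁻¹`, and let `c` be the maximal absolute value of an entry of `C`. Then every `r × r`
row submatrix `A_κ` of `A` satisfies `|det A_κ| ≤ (c√r)^r · |det Â|`. -/
theorem statement15 (M r : ℕ) (A : Matrix (Fin M) (Fin r) ℂ)
    (ι : Fin r → Fin M) (hι : Function.Injective ι)
    (hinv : IsUnit (A.submatrix ι id).det)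
    (c : ℝ) (hc : c = ⨆ p : Fin M × Fin r, ‖(A * (A.submatrix ι id)⁻¹) p.1 p.2‖) :
    ∀ κ : Fin r → Fin M, Function.Injective κ →
      ‖(A.submatrix κ id).det‖
        ≤ (c * Real.sqrt r) ^ r * ‖(A.submatrix ι id).det‖ := by
  intro κ _
  have hA : A.submatrix κ id =
      (A * (A.submatrix ι id)⁻¹).submatrix κ id * A.submatrix ι id := by
    rw [submatrix_mul _ _ κ id id Function.bijective_id, submatrix_id_id, Matrix.mul_assoc,
      nonsing_inv_mul _ hinv, Matrix.mul_one]
  have hle : ∀ i j, ‖(A * (A.submatrix ι id)⁻¹).submatrix κ id i j‖ ≤ c := fun i j ↦ by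
    rw [hc]
    exact le_ciSup (f := fun p : Fin M × Fin r ↦ ‖(A * (A.submatrix ι id)⁻¹) p.1 p.2‖)
      (Set.finite_range _).bddAbove (κ i, j)
  rw [hA, det_mul, norm_mul]
  gcongr
  simpa using norm_det_le_of_norm_le _ hle
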